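/- Let n ≥ 5 and let u : ZMod n → ℤ² be the ray data of a complete smooth fan in ℝ² (each u_i primitive, det(u_i, u_{i+1}) = 1 for all i, the cones Cone(u_i, u_{i+1}) cover ℝ², and distinct such cones have disjoint interiors), and set γ_i = det(u_{i-1}, u_{i+1}). Let Δ ⊆ ZMod n with card(Δ) ∈ {1, 2} and define a_i = 0 if i ∈ Δ and a_i = 1 otherwise. Then there exists i ∈ ZMod n such that a_{i-1} + a_{i+1} - γ_i · a_i ≤ 0. (Equivalently, for a complete smooth toric surface X of Picard rank at least 3 and a reduced invariant divisor D with one or two components, -(K_X + D) is not ample.) -/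

import Mathlib

/-- `det(u, v) = u₁v₂ - u₂v₁` for `u, v ∈ ℤ²`. -/
def det2 (u v : ℤ × ℤ) : ℤ := u.1 * v.2 - u.2 * v.1

/-- The embedding `ℤ² → ℝ²`. -/
noncomputable def toR2 (u : ℤ × ℤ) : ℝ × ℝ := ((u.1 : ℝ), (u.2 : ℝ))

/-- The cone `Cone(u, v) = {s·u + t·v : s, t ≥ 0} ⊆ ℝ²` spanned by `u, v ∈ ℤ²`. -/
def coneR (u v : ℤ × ℤ) : Set (ℝ × ℝ) :=
  {x | ∃ s t : ℝ, 0 ≤ s ∧ 0 ≤ t ∧ x = s • toR2 u + t • toR2 v}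

/-- The interior `{s·u + t·v : s, t > 0}` of the cone spanned by `u, v ∈ ℤ²`. -/
def coneIntR (u v : ℤ × ℤ) : Set (ℝ × ℝ) :=
  {x | ∃ s t : ℝ, 0 < s ∧ 0 < t ∧ x = s • toR2 u + t • toR2 v}

/-- `u : ZMod n → ℤ²` is the ray data of a complete smooth fan in `ℝ²`:
each `u i` is primitive, `det(u i, u (i+1)) = 1`, the cones `Cone(u i, u (i+1))`
cover `ℝ²`, and distinct such cones have disjoint interiors. -/
structure IsCompleteSmoothFan {n : ℕ} (u : ZMod n → ℤ × ℤ) : Prop where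
  primitive : ∀ i, Int.gcd (u i).1 (u i).2 = 1
  det_succ : ∀ i, det2 (u i) (u (i + 1)) = 1
  covers : ∀ x : ℝ × ℝ, ∃ i, x ∈ coneR (u i) (u (i + 1))
  disjoint_interiors : ∀ i j, i ≠ j →
    coneIntR (u i) (u (i + 1)) ∩ coneIntR (u j) (u (j + 1)) = ∅

theorem mem_coneIntR_of_det2_pos {u v x : ℤ × ℤ} (huv : det2 u v = 1)
    (hu : 0 < det2 u x) (hv : 0 < det2 x v) : toR2 x ∈ coneIntR u v := by
  refine ⟨det2 x v, det2 u x, by exact_mod_cast hv, by exact_mod_cast hu, ?_⟩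
  have huv' : (u.1 : ℝ) * v.2 - u.2 * v.1 = 1 := by
    have h := congrArg (Int.cast (R := ℝ)) huv
    simpa [det2] using h
  ext
  · simp only [toR2, det2, Prod.fst_add, Prod.smul_fst, smul_eq_mul]
    push_cast
    linear_combination -(x.1 : ℝ) * huv'
  · simp only [toR2, det2, Prod.snd_add, Prod.smul_snd, smul_eq_mul]
    push_cast
    linear_combination -(x.2 : ℝ) * huv'

theorem exists_pos_mul_add_pos_and_ne_zero {A B C D : ℤ} (hA : 0 < A) (hCD : C ≠ 0 ∨ D ≠ 0) :
    ∃ N : ℤ, 0 < N ∧ 0 < N * A + B ∧ N * C + D ≠ 0 := by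
  refine ⟨|B| + |D| + 1, by positivity, ?_, ?_⟩
  · nlinarith [neg_abs_le B, abs_nonneg B, abs_nonneg D]
  · intro h
    rcases eq_or_ne C 0 with rfl | hC
    · simp_all
    · have h1 : |D| = (|B| + |D| + 1) * |C| := by
        have h2 := congrArg abs (eq_neg_of_add_eq_zero_left h)
        rw [abs_mul, abs_neg, abs_of_pos (show 0 < |B| + |D| + 1 by positivity)] at h2
        exact h2.symm
      nlinarith [abs_pos.mpr hC, abs_nonneg B, abs_nonneg D]

namespace IsCompleteSmoothFan

variable {n : ℕ} {u : ZMod n → ℤ × ℤ}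

theorem not_det2_pos (hu : IsCompleteSmoothFan u) {i j : ZMod n} (hij : i ≠ j) {x : ℤ × ℤ}
    (hi : 0 < det2 (u i) x) (hi' : 0 < det2 x (u (i + 1)))
    (hj : 0 < det2 (u j) x) (hj' : 0 < det2 x (u (j + 1))) : False := by
  have h : toR2 x ∈ coneIntR (u i) (u (i + 1)) ∩ coneIntR (u j) (u (j + 1)) :=
    ⟨mem_coneIntR_of_det2_pos (hu.det_succ i) hi hi',
      mem_coneIntR_of_det2_pos (hu.det_succ j) hj hj'⟩
  rw [hu.disjoint_interiors i j hij] at h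
  exact h

theorem det_pred (hu : IsCompleteSmoothFan u) (i : ZMod n) : det2 (u (i - 1)) (u i) = 1 := by
  simpa using hu.det_succ (i - 1)

theorem det2_succ_right (hu : IsCompleteSmoothFan u) (i : ZMod n) (x : ℤ × ℤ) :
    det2 x (u (i + 1)) =
      det2 (u (i - 1)) (u (i + 1)) * det2 x (u i) - det2 x (u (i - 1)) := by
  have h1 := hu.det_pred i
  have h2 := hu.det_succ i
  simp only [det2] at *
  linear_combination (x.2 * (u (i + 1)).1 - x.1 * (u (i + 1)).2) * h1 +
    (x.2 * (u (i - 1)).1 - x.1 * (u (i - 1)).2) * h2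

/-- If `γ i ≤ 0`, the two cones at `u i` contain the half-plane to the left of `u (i - 1)`,
up to the ray of `u i`, so that half-plane meets the interior of no other cone. -/
theorem det2_eq_zero_of_mem_cone (hu : IsCompleteSmoothFan u) {i k : ZMod n}
    (hγ : det2 (u (i - 1)) (u (i + 1)) ≤ 0) (hk : k ≠ i - 1) (hk' : k ≠ i) {x : ℤ × ℤ}
    (hx : 0 < det2 (u k) x) (hx' : 0 < det2 x (u (k + 1)))
    (hp : 0 < det2 (u (i - 1)) x) : det2 (u i) x = 0 := by
  have swap : ∀ v : ℤ × ℤ, det2 x v = -det2 v x := fun v => by simp only [det2]; ring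
  by_contra hq
  rcases lt_or_gt_of_ne hq with hq | hq
  · refine hu.not_det2_pos hk hx hx' hp ?_
    rw [sub_add_cancel, swap]
    linarith
  · refine hu.not_det2_pos hk' hx hx' hq ?_
    rw [hu.det2_succ_right i x, swap, swap]
    nlinarith

theorem det2_nonpos (hu : IsCompleteSmoothFan u) {i k : ZMod n}
    (hγ : det2 (u (i - 1)) (u (i + 1)) ≤ 0) (hk : k ≠ i - 1) (hk' : k ≠ i) :
    det2 (u (i - 1)) (u k) ≤ 0 ∧ det2 (u (i - 1)) (u (k + 1)) ≤ 0 := by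
  have h1 := hu.det_pred i
  have h2 := hu.det_succ k
  have plucker : det2 (u (i - 1)) (u k) * det2 (u i) (u (k + 1)) -
      det2 (u (i - 1)) (u (k + 1)) * det2 (u i) (u k) = 1 := by
    simp only [det2] at *
    linear_combination ((u k).1 * (u (k + 1)).2 - (u k).2 * (u (k + 1)).1) * h1 + h2
  have expand : ∀ (v : ℤ × ℤ) (s t : ℤ), det2 v (s • u k + t • u (k + 1)) =
      s * det2 v (u k) + t * det2 v (u (k + 1)) := fun v s t => by
    simp [det2]; ring
  have left : ∀ s t : ℤ, det2 (u k) (s • u k + t • u (k + 1)) = t := fun s t => by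
    rw [expand, h2]; simp only [det2]; ring
  have right : ∀ s t : ℤ, det2 (s • u k + t • u (k + 1)) (u (k + 1)) = s := fun s t => by
    simp [det2] at *; linear_combination s * h2
  have key : ∀ s t : ℤ, 0 < s → 0 < t →
      0 < s * det2 (u (i - 1)) (u k) + t * det2 (u (i - 1)) (u (k + 1)) →
      s * det2 (u i) (u k) + t * det2 (u i) (u (k + 1)) = 0 := fun s t hs ht h => by
    rw [← expand] at h ⊢
    exact hu.det2_eq_zero_of_mem_cone hγ hk hk' (by rwa [left]) (by rwa [right]) h
  have hne : det2 (u i) (u k) ≠ 0 ∨ det2 (u i) (u (k + 1)) ≠ 0 := by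
    by_contra! h
    simp [h.1, h.2] at plucker
  constructor
  · by_contra! h
    obtain ⟨N, hN, hpos, hN'⟩ := exists_pos_mul_add_pos_and_ne_zero
      (B := det2 (u (i - 1)) (u (k + 1))) h hne
    exact hN' (by simpa using key N 1 hN one_pos (by simpa using hpos))
  · by_contra! h
    obtain ⟨N, hN, hpos, hN'⟩ := exists_pos_mul_add_pos_and_ne_zero
      (B := det2 (u (i - 1)) (u k)) h hne.symm
    exact hN' (by linarith [key 1 N one_pos hN (by linarith)])

/-- With at least five rays, two curves of nonnegative self-intersection are equal or adjacent. -/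
theorem false_of_nonpos_of_nonpos (hn : 5 ≤ n) (hu : IsCompleteSmoothFan u) {i j : ZMod n}
    (hi : det2 (u (i - 1)) (u (i + 1)) ≤ 0) (hj : det2 (u (j - 1)) (u (j + 1)) ≤ 0)
    (hij : j ≠ i) (hij' : j ≠ i - 1) (hij'' : j ≠ i + 1) : False := by
  have : NeZero n := ⟨by omega⟩
  obtain ⟨k, hk⟩ : ∃ k, k ∉ ({i - 1, i, j - 1, j} : Finset (ZMod n)) := by
    by_contra! h
    have h1 := Finset.card_le_four (a := i - 1) (b := i) (c := j - 1) (d := j)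
    rw [Finset.eq_univ_iff_forall.mpr h, Finset.card_univ, ZMod.card] at h1
    omega
  simp only [Finset.mem_insert, Finset.mem_singleton, not_or] at hk
  obtain ⟨hk1, hk2, hk3, hk4⟩ := hk
  have hpp : det2 (u (i - 1)) (u (j - 1)) ≤ 0 :=
    (hu.det2_nonpos hi (k := j - 1) (fun h => hij (sub_left_injective h))
      (fun h => hij'' (by rw [← h]; ring))).1
  obtain ⟨hpq, hpr⟩ := hu.det2_nonpos hi hij' hij
  obtain ⟨hv, hw⟩ := hu.det2_nonpos hi hk1 hk2
  obtain ⟨hv', hw'⟩ := hu.det2_nonpos hj hk3 hk4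
  rw [hu.det2_succ_right] at hpr
  have hpp0 : det2 (u (i - 1)) (u (j - 1)) = 0 := by nlinarith
  have hq := hu.det_pred j
  have vanish : ∀ x, det2 (u (i - 1)) x ≤ 0 → det2 (u (j - 1)) x ≤ 0 →
      det2 (u (i - 1)) x = 0 := fun x hx hx' => by
    have h : det2 (u (i - 1)) x = det2 (u (i - 1)) (u j) * det2 (u (j - 1)) x := by
      simp only [det2] at *
      linear_combination (x.1 * (u (i - 1)).2 - x.2 * (u (i - 1)).1) * hq +
        (x.1 * (u j).2 - x.2 * (u j).1) * hpp0
    nlinarith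
  have hv0 := vanish _ hv hv'
  have hw0 := vanish _ hw hw'
  have h1 := hu.det_pred i
  have h2 := hu.det_succ k
  have plucker : det2 (u (i - 1)) (u i) * det2 (u k) (u (k + 1)) =
      det2 (u (i - 1)) (u k) * det2 (u i) (u (k + 1)) -
        det2 (u (i - 1)) (u (k + 1)) * det2 (u i) (u k) := by
    simp only [det2]; ring
  rw [h1, h2, hv0, hw0] at plucker
  simp at plucker

end IsCompleteSmoothFan

theorem exists_isolated_or_eq_pair {n : ℕ} {Δ : Finset (ZMod n)}
    (hΔ : Δ.card = 1 ∨ Δ.card = 2) (h1 : (1 : ZMod n) ≠ 0) :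
    (∃ c ∈ Δ, c + 1 ∉ Δ ∧ c - 1 ∉ Δ) ∨ ∃ c, Δ = {c, c + 1} := by
  have hs : ∀ c : ZMod n, c + 1 ≠ c := fun c h => h1 (by simpa using h)
  have hp : ∀ c : ZMod n, c - 1 ≠ c := fun c h => h1 (by simpa using h)
  rcases hΔ with hΔ | hΔ
  · obtain ⟨c, rfl⟩ := Finset.card_eq_one.mp hΔ
    exact Or.inl ⟨c, by simp, by simpa using hs c, by simpa using hp c⟩
  · obtain ⟨c, d, -, rfl⟩ := Finset.card_eq_two.mp hΔ
    by_cases hd : d = c + 1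
    · exact Or.inr ⟨c, by rw [hd]⟩
    by_cases hc : c = d + 1
    · exact Or.inr ⟨d, by rw [hc, Finset.pair_comm]⟩
    refine Or.inl ⟨c, by simp, ?_, ?_⟩
    · simpa using ⟨h1, fun h => hd h.symm⟩
    · simpa using ⟨h1, fun h => hc (by rw [← h]; ring)⟩

/-- For a complete smooth toric surface `X` of Picard rank at least `3`
(i.e. `n ≥ 5` rays) and a reduced invariant divisor `D = Σ_{i∈Δ} D_i` with one
or two components, `-(K_X + D)` is not ample: some ampleness inequality
`a_{i-1} + a_{i+1} - γ_i a_i > 0` fails. -/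
theorem not_ample_of_card_one_or_two {n : ℕ} (hn : 5 ≤ n)
    (u : ZMod n → ℤ × ℤ) (hu : IsCompleteSmoothFan u)
    (γ : ZMod n → ℤ) (hγ : ∀ i, γ i = det2 (u (i - 1)) (u (i + 1)))
    (Δ : Finset (ZMod n)) (hΔ : Δ.card = 1 ∨ Δ.card = 2)
    (a : ZMod n → ℤ) (ha : ∀ i, a i = if i ∈ Δ then 0 else 1) :
    ∃ i : ZMod n, a (i - 1) + a (i + 1) - γ i * a i ≤ 0 := by
  by_contra! hample
  have hle : ∀ i, a i ≤ 1 := fun i => by rw [ha]; split_ifs <;> norm_num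
  have hne : ∀ m : ℕ, 0 < m → m < 5 → (m : ZMod n) ≠ 0 := fun m h0 h5 h =>
    absurd (Nat.le_of_dvd h0 ((ZMod.natCast_eq_zero_iff m n).mp h)) (by omega)
  have h1 : (1 : ZMod n) ≠ 0 := by exact_mod_cast hne 1 (by norm_num) (by norm_num)
  have h2 : (2 : ZMod n) ≠ 0 := by exact_mod_cast hne 2 (by norm_num) (by norm_num)
  have h3 : (3 : ZMod n) ≠ 0 := by exact_mod_cast hne 3 (by norm_num) (by norm_num)
  have h4 : (4 : ZMod n) ≠ 0 := by exact_mod_cast hne 4 (by norm_num) (by norm_num)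
  have hsucc : ∀ c ∈ Δ, c + 1 ∉ Δ → det2 (u (c + 1 - 1)) (u (c + 1 + 1)) ≤ 0 := by
    intro c hc hc'
    have h := hample (c + 1)
    rw [hγ, ha (c + 1), if_neg hc', ha (c + 1 - 1), if_pos (by simpa using hc)] at h
    linarith [hle (c + 1 + 1)]
  have hpred : ∀ c ∈ Δ, c - 1 ∉ Δ → det2 (u (c - 1 - 1)) (u (c - 1 + 1)) ≤ 0 := by
    intro c hc hc'
    have h := hample (c - 1)
    rw [hγ, ha (c - 1), if_neg hc', ha (c - 1 + 1), if_pos (by simpa using hc)] at h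
    linarith [hle (c - 1 - 1)]
  rcases exists_isolated_or_eq_pair hΔ h1 with ⟨c, hc, hc1, hc2⟩ | ⟨c, rfl⟩
  · exact hu.false_of_nonpos_of_nonpos hn (hsucc c hc hc1) (hpred c hc hc2)
      (fun h => h2 (by linear_combination -h)) (fun h => h1 (by linear_combination -h))
      (fun h => h3 (by linear_combination -h))
  · refine hu.false_of_nonpos_of_nonpos hn (hsucc (c + 1) (by simp) ?_) (hpred c (by simp) ?_)
      (fun h => h3 (by linear_combination -h)) (fun h => h2 (by linear_combination -h))
      (fun h => h4 (by linear_combination -h))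
    · simp only [Finset.mem_insert, Finset.mem_singleton, not_or]
      exact ⟨fun h => h2 (by linear_combination h), fun h => h1 (by linear_combination h)⟩
    · simp only [Finset.mem_insert, Finset.mem_singleton, not_or]
      exact ⟨fun h => h1 (by linear_combination -h), fun h => h2 (by linear_combination -h)⟩
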